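/- arXiv:1703.04889 — 2 statements merged into one kernel-verified Lean document; each statement's English description precedes it below -/
import Mathlib

section
/- Let p, q ≥ 1. For 1 ≤ i < j ≤ q define u^{(ij)} = ∏_{k=1}^{p} (e_{ki} + √−1 e_{kj}) and v^{(ij)} = ∏_{k=1}^{p} (e_{ki} − √−1 e_{kj}) in Cl(p,q), the products taken in increasing order of k. Then for all 1 ≤ r, s ≤ p: [∑_{l=1}^{q} e_{rl} e_{sl}, u^{(ij)}] = 0 and [∑_{l=1}^{q} e_{rl} e_{sl}, v^{(ij)}] = 0. (This is the Clifford-algebra core of the claim that u^{(ij)} and v^{(ij)} lie in the commutant of L_{ŝo_p}(q,0).) -/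
/-- The quadratic form `Q(v) = (1/2) ∑ v_{kj}²` on `ℂ^{Fin p × Fin q}`. -/
noncomputable def halfSumSq (ι : Type*) [Fintype ι] : QuadraticForm ℂ (ι → ℂ) :=
  QuadraticMap.weightedSumSquares ℂ (fun _ : ι => (1 / 2 : ℂ))

/-- The Clifford algebra `Cl(p,q)` on generators `e_{kj}`, `1 ≤ k ≤ p`, `1 ≤ j ≤ q`, with
relations `e_{ki} e_{lj} + e_{lj} e_{ki} = δ_{kl} δ_{ij}`. -/
noncomputable abbrev Clpq (p q : ℕ) := CliffordAlgebra (halfSumSq (Fin p × Fin q))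

/-- The generator `e_{kj}` of `Cl(p,q)`. -/
noncomputable def eGen (p q : ℕ) (k : Fin p) (j : Fin q) : Clpq p q :=
  CliffordAlgebra.ι (halfSumSq (Fin p × Fin q)) (Pi.single (k, j) 1)

/-- `u^{(ij)} = ∏_{k=1}^{p} (e_{ki} + i e_{kj})`, product in increasing order of `k`. -/
noncomputable def uElt (p q : ℕ) (i j : Fin q) : Clpq p q :=
  (List.ofFn fun k : Fin p => eGen p q k i + Complex.I • eGen p q k j).prod

/-- `v^{(ij)} = ∏_{k=1}^{p} (e_{ki} − i e_{kj})`, product in increasing order of `k`. -/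
noncomputable def vElt (p q : ℕ) (i j : Fin q) : Clpq p q :=
  (List.ofFn fun k : Fin p => eGen p q k i - Complex.I • eGen p q k j).prod

theorem eGen_anticomm (p q : ℕ) (k l : Fin p) (i j : Fin q) :
    eGen p q k i * eGen p q l j + eGen p q l j * eGen p q k i
      = if k = l ∧ i = j then 1 else 0 := by
  unfold eGen
  rw [CliffordAlgebra.ι_mul_ι_add_swap]
  have h : QuadraticMap.polar (halfSumSq (Fin p × Fin q)) (Pi.single (k, i) 1)
      (Pi.single (l, j) 1) = if k = l ∧ i = j then 1 else 0 := by
    have h1 : ∀ x y : Fin p × Fin q → ℂ,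
        QuadraticMap.polar (halfSumSq (Fin p × Fin q)) x y = ∑ t, x t * y t := by
      intro x y
      simp only [QuadraticMap.polar, halfSumSq, QuadraticMap.weightedSumSquares_apply,
        ← Finset.sum_sub_distrib, Pi.add_apply, smul_eq_mul]
      refine Finset.sum_congr rfl fun t _ => ?_
      ring
    rw [h1]
    simp only [Pi.single_apply, ite_mul, one_mul, zero_mul, Finset.sum_ite_eq',
      Finset.sum_ite_eq, Finset.mem_univ, if_true, Prod.mk.injEq]
  rw [h]
  split_ifs <;> simp

theorem perm_prod_sign {α R : Type*} [Ring R] (w : α → R)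
    (h : ∀ a b, w a * w b = -(w b * w a)) {l₁ l₂ : List α} (hl : l₁.Perm l₂) :
    (l₁.map w).prod = (l₂.map w).prod ∨ (l₁.map w).prod = -(l₂.map w).prod := by
  induction hl with
  | nil => simp
  | cons x _ ih =>
    rcases ih with ih | ih <;> simp [ih]
  | swap x y l =>
    right
    simp only [List.map_cons, List.prod_cons, ← mul_assoc]
    rw [h y x, neg_mul]
  | trans _ _ ih1 ih2 =>
    rcases ih1 with h1 | h1 <;> rcases ih2 with h2 | h2 <;> simp [h1, h2]

theorem commute_prod_aux {p : ℕ} {R : Type*} [Ring R] (w : Fin p → R) (X : R) (r s : Fin p)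
    (h : ∀ a b, w a * w b = -(w b * w a)) (h0 : ∀ a, w a * w a = 0)
    (hX : ∀ k, X * w k - w k * X = (if k = s then w r else 0) - (if k = r then w s else 0)) :
    Commute X (List.ofFn w).prod := by
  by_cases hrs : r = s
  · subst hrs
    refine Commute.list_prod_right _ _ fun y hy => ?_
    obtain ⟨k, rfl⟩ := (List.mem_ofFn' _ _).1 hy
    have := hX k
    rw [sub_self, sub_eq_zero] at this
    exact this
  · have hperm : (List.finRange p).Perm (r :: s :: ((List.finRange p).erase r).erase s) := by
      refine (List.perm_cons_erase (List.mem_finRange r)).trans (List.Perm.cons _ ?_)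
      exact List.perm_cons_erase ((List.mem_erase_of_ne (Ne.symm hrs)).2 (List.mem_finRange s))
    have hc : Commute X
        ((r :: s :: ((List.finRange p).erase r).erase s).map w).prod := by
      rw [List.map_cons, List.map_cons, List.prod_cons, List.prod_cons, ← mul_assoc]
      refine Commute.mul_right ?_ (Commute.list_prod_right _ _ fun y hy => ?_)
      · have hr := hX r
        have hs := hX s
        simp only [if_true, if_neg hrs, if_neg (Ne.symm hrs), zero_sub, sub_zero] at hr hs
        have e : X * (w r * w s) - w r * w s * X
            = (X * w r - w r * X) * w s + w r * (X * w s - w s * X) := by noncomm_ring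
        rw [hr, hs, neg_mul, h0, h0, neg_zero, add_zero] at e
        exact sub_eq_zero.1 e
      · obtain ⟨k, hk, rfl⟩ := List.mem_map.1 hy
        have nd := List.nodup_finRange p
        have hks := ((nd.erase r).mem_erase_iff).1 hk
        have hkr := (nd.mem_erase_iff).1 hks.2
        have := hX k
        rw [if_neg hks.1, if_neg hkr.1, sub_self, sub_eq_zero] at this
        exact this
    rw [List.ofFn_eq_map]
    rcases perm_prod_sign w h hperm with e | e <;> rw [e]
    · exact hc
    · exact hc.neg_right

theorem commute_general (p q : ℕ) (i j : Fin q) (hij : i ≠ j) (r s : Fin p) (c : ℂ)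
    (hc : c * c = -1) :
    Commute (∑ l : Fin q, eGen p q r l * eGen p q s l)
      (List.ofFn fun k : Fin p => eGen p q k i + c • eGen p q k j).prod := by
  have anti : ∀ a b, (eGen p q a i + c • eGen p q a j) * (eGen p q b i + c • eGen p q b j)
      + (eGen p q b i + c • eGen p q b j) * (eGen p q a i + c • eGen p q a j) = 0 := by
    intro a b
    have e : (eGen p q a i + c • eGen p q a j) * (eGen p q b i + c • eGen p q b j)
      + (eGen p q b i + c • eGen p q b j) * (eGen p q a i + c • eGen p q a j)
      = (eGen p q a i * eGen p q b i + eGen p q b i * eGen p q a i)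
        + c • (eGen p q a i * eGen p q b j + eGen p q b j * eGen p q a i)
        + c • (eGen p q a j * eGen p q b i + eGen p q b i * eGen p q a j)
        + (c * c) • (eGen p q a j * eGen p q b j + eGen p q b j * eGen p q a j) := by
      simp only [add_mul, mul_add, smul_mul_assoc, mul_smul_comm, smul_add, mul_smul]
      abel
    rw [e]
    simp only [eGen_anticomm, hc, hij, hij.symm]
    by_cases hab : a = b <;> simp [hab]
  refine commute_prod_aux _ _ r s (fun a b => eq_neg_of_add_eq_zero_left (anti a b)) ?_ ?_
  · intro a
    have h2 := anti a a
    rw [← two_smul ℂ] at h2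
    exact (smul_eq_zero.1 h2).resolve_left two_ne_zero
  · intro k
    have key : ∀ (m : Fin q), (∑ l : Fin q, eGen p q r l * eGen p q s l) * eGen p q k m
        - eGen p q k m * (∑ l : Fin q, eGen p q r l * eGen p q s l)
        = (if k = s then eGen p q r m else 0) - (if k = r then eGen p q s m else 0) := by
      intro m
      have e : ∀ l, eGen p q r l * eGen p q s l * eGen p q k m
          - eGen p q k m * (eGen p q r l * eGen p q s l)
          = eGen p q r l * (if s = k ∧ l = m then 1 else 0)
            - (if r = k ∧ l = m then 1 else 0) * eGen p q s l := by
        intro l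
        rw [← eGen_anticomm, ← eGen_anticomm]
        noncomm_ring
      rw [Finset.sum_mul, Finset.mul_sum, ← Finset.sum_sub_distrib,
        Finset.sum_congr rfl fun l _ => e l, Finset.sum_sub_distrib]
      congr 1
      · by_cases h : k = s
        · simp [h]
        · simp [h, Ne.symm h]
      · by_cases h : k = r
        · simp [h]
        · simp [h, Ne.symm h]
    have e2 : ∀ X a b : Clpq p q, X * (a + c • b) - (a + c • b) * X
        = (X * a - a * X) + c • (X * b - b * X) := by
      intro X a b
      simp only [add_mul, mul_add, smul_mul_assoc, mul_smul_comm, smul_sub]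
      abel
    rw [e2, key, key]
    split_ifs <;> simp [smul_sub] <;> abel

/-- For `i < j`, the elements `u^{(ij)}` and `v^{(ij)}` commute with all the elements
`∑_{l=1}^{q} e_{rl} e_{sl}` of `Cl(p,q)`. -/
theorem uv_commute_with_currents (p q : ℕ) (hp : 1 ≤ p) (hq : 1 ≤ q)
    (i j : Fin q) (hij : i < j) (r s : Fin p) :
    ((∑ l : Fin q, eGen p q r l * eGen p q s l) * uElt p q i j
      - uElt p q i j * (∑ l : Fin q, eGen p q r l * eGen p q s l) = 0) ∧
    ((∑ l : Fin q, eGen p q r l * eGen p q s l) * vElt p q i j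
      - vElt p q i j * (∑ l : Fin q, eGen p q r l * eGen p q s l) = 0) := by
  refine ⟨sub_eq_zero.2 (commute_general p q i j hij.ne r s Complex.I Complex.I_mul_I).eq, ?_⟩
  have h := (commute_general p q i j hij.ne r s (-Complex.I) (by simp)).eq
  simp only [neg_smul, ← sub_eq_add_neg] at h
  exact sub_eq_zero.2 h
end

section
/- Let p, q ≥ 1 and 1 ≤ i < j ≤ q. With u^{(ij)} = ∏_{k=1}^{p} (e_{ki} + √−1 e_{kj}) and v^{(ij)} = ∏_{k=1}^{p} (e_{ki} − √−1 e_{kj}) in Cl(p,q) (products in increasing order of k), set B = √−1 ∑_{k=1}^{p} e_{kj} e_{ki}. Then [B, u^{(ij)}] = p · u^{(ij)} and [B, v^{(ij)}] = −p · v^{(ij)}. (For p = 2m, i = 1, j = N+1 this is the paper's computation β₁^∨(0) u^{(1,N+1)} = 2m u^{(1,N+1)} and β₁^∨(0) v^{(1,N+1)} = −2m v^{(1,N+1)}.) -/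
theorem eGen_anti (p q : ℕ) (k l : Fin p) (i j : Fin q) :
    eGen p q k i * eGen p q l j + eGen p q l j * eGen p q k i
      = if (k, i) = (l, j) then 1 else 0 := by
  unfold eGen
  rw [CliffordAlgebra.ι_mul_ι_add_swap]
  have h : QuadraticMap.polar (halfSumSq (Fin p × Fin q)) (Pi.single (k, i) 1)
      (Pi.single (l, j) 1) = if (k, i) = (l, j) then 1 else 0 := by
    simp only [QuadraticMap.polar, halfSumSq, QuadraticMap.weightedSumSquares_apply,
      ← Finset.sum_sub_distrib]
    have : ∀ x : Fin p × Fin q,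
        (1 / 2 : ℂ) • (((Pi.single (k, i) 1 + Pi.single (l, j) 1 : Fin p × Fin q → ℂ) x) *
          ((Pi.single (k, i) 1 + Pi.single (l, j) 1 : Fin p × Fin q → ℂ) x)) -
        (1 / 2 : ℂ) • ((Pi.single (k, i) 1 : Fin p × Fin q → ℂ) x *
          (Pi.single (k, i) 1 : Fin p × Fin q → ℂ) x) -
        (1 / 2 : ℂ) • ((Pi.single (l, j) 1 : Fin p × Fin q → ℂ) x *
          (Pi.single (l, j) 1 : Fin p × Fin q → ℂ) x)
        = (Pi.single (k, i) 1 : Fin p × Fin q → ℂ) x *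
          (Pi.single (l, j) 1 : Fin p × Fin q → ℂ) x := by
      intro x
      simp only [Pi.add_apply, smul_eq_mul]
      ring
    rw [Finset.sum_congr rfl fun x _ => this x]
    simp [Pi.single_apply, eq_comm]
  rw [h]
  split_ifs <;> simp

theorem comm_aux {A : Type*} [Ring A] (b a x : A) :
    b * a * x - x * (b * a) = b * (a * x + x * a) - (b * x + x * b) * a := by
  noncomm_ring

theorem comm_i (p q : ℕ) (i j : Fin q) (hij : i ≠ j) (l : Fin p) :
    (∑ k : Fin p, eGen p q k j * eGen p q k i) * eGen p q l i
      - eGen p q l i * (∑ k : Fin p, eGen p q k j * eGen p q k i) = eGen p q l j := by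
  rw [Finset.sum_mul, Finset.mul_sum, ← Finset.sum_sub_distrib]
  simp [comm_aux, eGen_anti, hij.symm]

theorem comm_j (p q : ℕ) (i j : Fin q) (hij : i ≠ j) (l : Fin p) :
    (∑ k : Fin p, eGen p q k j * eGen p q k i) * eGen p q l j
      - eGen p q l j * (∑ k : Fin p, eGen p q k j * eGen p q k i) = - eGen p q l i := by
  rw [Finset.sum_mul, Finset.mul_sum, ← Finset.sum_sub_distrib]
  simp [comm_aux, eGen_anti, hij]

theorem comm_list {A : Type*} [Ring A] [Algebra ℂ A] (B : A) (c : ℂ) (L : List A)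
    (h : ∀ x ∈ L, B * x - x * B = c • x) :
    B * L.prod - L.prod * B = ((L.length : ℂ) * c) • L.prod := by
  induction L with
  | nil => simp
  | cons x L ih =>
    have h1 := h x (by simp)
    have h2 := ih fun y hy => h y (by simp [hy])
    rw [List.prod_cons, List.length_cons]
    calc B * (x * L.prod) - x * L.prod * B
        = (B * x - x * B) * L.prod + x * (B * L.prod - L.prod * B) := by noncomm_ring
      _ = _ := by
        rw [h1, h2, smul_mul_assoc, mul_smul_comm, ← add_smul]
        push_cast
        congr 1
        ring

/-- For `i < j` and `B = √−1 ∑_{k=1}^{p} e_{kj} e_{ki}`, one has `[B, u^{(ij)}] = p·u^{(ij)}`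
and `[B, v^{(ij)}] = −p·v^{(ij)}`. -/
theorem B_eigenvalues_on_uv (p q : ℕ) (hp : 1 ≤ p) (hq : 1 ≤ q)
    (i j : Fin q) (hij : i < j)
    (B : Clpq p q) (hB : B = Complex.I • ∑ k : Fin p, eGen p q k j * eGen p q k i) :
    (B * uElt p q i j - uElt p q i j * B = (p : ℂ) • uElt p q i j) ∧
    (B * vElt p q i j - vElt p q i j * B = -(p : ℂ) • vElt p q i j) := by
  have hi : ∀ l, B * eGen p q l i - eGen p q l i * B = Complex.I • eGen p q l j := by
    intro l
    rw [hB, smul_mul_assoc, mul_smul_comm, ← smul_sub, comm_i p q i j hij.ne]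
  have hj : ∀ l, B * eGen p q l j - eGen p q l j * B = -(Complex.I • eGen p q l i) := by
    intro l
    rw [hB, smul_mul_assoc, mul_smul_comm, ← smul_sub, comm_j p q i j hij.ne, smul_neg]
  clear hB
  constructor
  · have := comm_list B 1 (List.ofFn fun k : Fin p => eGen p q k i + Complex.I • eGen p q k j) (by
      intro x hx
      obtain ⟨l, rfl⟩ := (List.mem_ofFn' _ _).1 hx
      calc _ = (B * eGen p q l i - eGen p q l i * B)
            + Complex.I • (B * eGen p q l j - eGen p q l j * B) := by
            rw [mul_add, add_mul, mul_smul_comm, smul_mul_assoc, smul_sub]; abel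
        _ = _ := by
            rw [hi, hj, smul_neg, smul_smul, Complex.I_mul_I]
            simp [add_comm])
    simpa [uElt] using this
  · have := comm_list B (-1) (List.ofFn fun k : Fin p => eGen p q k i - Complex.I • eGen p q k j) (by
      intro x hx
      obtain ⟨l, rfl⟩ := (List.mem_ofFn' _ _).1 hx
      calc _ = (B * eGen p q l i - eGen p q l i * B)
            - Complex.I • (B * eGen p q l j - eGen p q l j * B) := by
            rw [mul_sub, sub_mul, mul_smul_comm, smul_mul_assoc, smul_sub]; abel
        _ = _ := by
            rw [hi, hj, smul_neg, smul_smul, Complex.I_mul_I]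
            simp [sub_eq_add_neg, add_comm])
    simpa [vElt] using this
end
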